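/- On H_m(𝔹), for every multi-index γ ∈ ℕⁿ the Brown–Halmos type identity M_z'^* M_z^γ M_z' = P_{Im M_z*} (⊕ ∑_{j=0}^{m-1} (-1)^j C(m, j+1) σ_{M_z}^j (M_z^γ)) P_{Im M_z*} holds, where M_z' = δ M_z. -/

import Mathlib

open scoped InnerProductSpace

set_option synthInstance.maxHeartbeats 400000
set_option maxHeartbeats 800000

instance piLp_completeSpace {H : Type*} [NormedAddCommGroup H] [InnerProductSpace ℂ H]
    [CompleteSpace H] {n : ℕ} : CompleteSpace (PiLp 2 (fun _ : Fin n => H)) := by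
  have e := (PiLp.continuousLinearEquiv 2 ℂ (fun _ : Fin n => H)).symm
  exact (e.isUniformEmbedding.isUniformInducing.completeSpace_congr e.surjective).mp inferInstance

/-- The weight `ρ_m(α) = (m+|α|-1)!/(α!(m-1)!)`. -/
noncomputable def rhoR (m : ℕ) {n : ℕ} (α : Fin n → ℕ) : ℝ :=
  ((m + (∑ i, α i) - 1).factorial : ℝ) /
    ((∏ i, ((α i).factorial : ℝ)) * ((m - 1).factorial : ℝ))

/-- `σ_{M_z}(X) = ∑ i, M_{z_i} X M_{z_i}*`. -/
noncomputable def sigmaOp {n : ℕ} {H : Type*} [NormedAddCommGroup H]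
    [InnerProductSpace ℂ H] [CompleteSpace H]
    (Mz : Fin n → H →L[ℂ] H) (X : H →L[ℂ] H) : H →L[ℂ] H :=
  ∑ i, (Mz i).comp (X.comp ((Mz i).adjoint))

/-- `M_z^γ = M_{z_1}^{γ_1} ⋯ M_{z_n}^{γ_n}`. -/
noncomputable def MzPow {n : ℕ} {H : Type*} [NormedAddCommGroup H]
    [InnerProductSpace ℂ H] [CompleteSpace H]
    (Mz : Fin n → H →L[ℂ] H) (γ : Fin n → ℕ) : H →L[ℂ] H :=
  (List.ofFn fun i => (Mz i) ^ (γ i)).prod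

section BHAux

theorem bh_rho_pos (m : ℕ) {n : ℕ} (α : Fin n → ℕ) : 0 < rhoR m α := by
  unfold rhoR
  have : 0 < ∏ i, ((α i).factorial : ℝ) := Finset.prod_pos fun i _ => by positivity
  positivity

theorem bh_sum_single {n : ℕ} (α : Fin n → ℕ) (i : Fin n) :
    ∑ j, (α + Pi.single i 1 : Fin n → ℕ) j = (∑ j, α j) + 1 := by
  simp [Finset.sum_add_distrib]

theorem bh_prod_single {n : ℕ} (α : Fin n → ℕ) (i : Fin n) :
    ∏ j, (((α + Pi.single i 1 : Fin n → ℕ) j).factorial : ℝ)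
      = (∏ j, ((α j).factorial : ℝ)) * ((α i : ℝ) + 1) := by
  rw [← Finset.mul_prod_erase _ _ (Finset.mem_univ i),
    ← Finset.mul_prod_erase (a := i) Finset.univ (fun j => ((α j).factorial : ℝ))
      (Finset.mem_univ i)]
  have : ∏ j ∈ Finset.univ.erase i, (((α + Pi.single i 1 : Fin n → ℕ) j).factorial : ℝ)
      = ∏ j ∈ Finset.univ.erase i, ((α j).factorial : ℝ) := by
    refine Finset.prod_congr rfl fun j hj => ?_
    have : j ≠ i := Finset.ne_of_mem_erase hj
    simp [this]
  rw [this]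
  simp [Nat.factorial_succ]
  ring

theorem bh_rho_succ (m : ℕ) (hm : 1 ≤ m) {n : ℕ} (α : Fin n → ℕ) (i : Fin n) :
    rhoR m (α + Pi.single i 1) * ((α i : ℝ) + 1) = rhoR m α * ((m : ℝ) + (∑ j, α j : ℕ)) := by
  unfold rhoR
  rw [bh_prod_single, bh_sum_single]
  have h : 0 < ∏ i, ((α i).factorial : ℝ) := Finset.prod_pos fun i _ => by positivity
  have h1 : ((m + ((∑ j, α j) + 1) - 1).factorial : ℝ)
      = ((m : ℝ) + (∑ j, α j : ℕ)) * ((m + (∑ j, α j) - 1).factorial : ℝ) := by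
    obtain ⟨p, rfl⟩ : ∃ p, m = p + 1 := ⟨m - 1, by omega⟩
    have e1 : p + 1 + ((∑ j, α j) + 1) - 1 = (p + ∑ j, α j) + 1 := by omega
    have e2 : p + 1 + (∑ j, α j) - 1 = p + ∑ j, α j := by omega
    rw [e1, e2, Nat.factorial_succ]
    push_cast
    ring
  rw [h1]
  have h2 : ((m - 1).factorial : ℝ) ≠ 0 := by positivity
  have h3 : (α i : ℝ) + 1 ≠ 0 := by positivity
  field_simp

variable {n m : ℕ} {H : Type*} [NormedAddCommGroup H] [InnerProductSpace ℂ H] [CompleteSpace H]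

theorem bh_ext_op {e : (Fin n → ℕ) → H} {F : Type*} [NormedAddCommGroup F] [NormedSpace ℂ F]
    (hdense : Dense ((Submodule.span ℂ (Set.range e) : Submodule ℂ H) : Set H))
    {A B : H →L[ℂ] F} (h : ∀ α, A (e α) = B (e α)) : A = B := by
  refine ContinuousLinearMap.ext_on hdense ?_
  rintro _ ⟨α, rfl⟩
  exact h α

theorem bh_ext_vec {e : (Fin n → ℕ) → H}
    (hdense : Dense ((Submodule.span ℂ (Set.range e) : Submodule ℂ H) : Set H))
    {x y : H} (h : ∀ α, ⟪e α, x⟫_ℂ = ⟪e α, y⟫_ℂ) : x = y := by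
  have : innerSL ℂ x = innerSL ℂ y := by
    refine bh_ext_op hdense fun α => ?_
    rw [innerSL_apply_apply, innerSL_apply_apply, ← inner_conj_symm, h, inner_conj_symm]
  exact (innerSL_inj).1 this

theorem bh_adj_zero {e : (Fin n → ℕ) → H}
    (horth : ∀ α β, ⟪e α, e β⟫_ℂ = if α = β then ((rhoR m α)⁻¹ : ℂ) else 0)
    (hdense : Dense ((Submodule.span ℂ (Set.range e) : Submodule ℂ H) : Set H))
    {Mz : Fin n → H →L[ℂ] H}
    (hMz : ∀ i α, Mz i (e α) = e (α + Pi.single i 1)) (i : Fin n) (α : Fin n → ℕ)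
    (h : α i = 0) : (Mz i).adjoint (e α) = 0 := by
  refine bh_ext_vec hdense fun β => ?_
  rw [ContinuousLinearMap.adjoint_inner_right, hMz, horth, if_neg, inner_zero_right]
  rintro rfl
  simp at h

theorem bh_adj_succ (hm : 1 ≤ m) {e : (Fin n → ℕ) → H}
    (horth : ∀ α β, ⟪e α, e β⟫_ℂ = if α = β then ((rhoR m α)⁻¹ : ℂ) else 0)
    (hdense : Dense ((Submodule.span ℂ (Set.range e) : Submodule ℂ H) : Set H))
    {Mz : Fin n → H →L[ℂ] H}
    (hMz : ∀ i α, Mz i (e α) = e (α + Pi.single i 1)) (i : Fin n) (α : Fin n → ℕ) :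
    (Mz i).adjoint (e (α + Pi.single i 1))
      = (((α i : ℂ) + 1) / ((m : ℂ) + (∑ j, α j : ℕ))) • e α := by
  refine bh_ext_vec hdense fun β => ?_
  rw [ContinuousLinearMap.adjoint_inner_right, hMz, horth, inner_smul_right, horth]
  by_cases hb : β = α
  · subst hb
    rw [if_pos rfl, if_pos rfl]
    have h1 : (rhoR m β : ℂ) ≠ 0 := by exact_mod_cast (bh_rho_pos m β).ne'
    have h2 : (rhoR m (β + Pi.single i 1) : ℂ) ≠ 0 := by exact_mod_cast (bh_rho_pos m _).ne'
    have h3 : ((m : ℂ) + (∑ j, β j : ℕ)) ≠ 0 := by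
      have : m + (∑ j, β j) ≠ 0 := by omega
      exact_mod_cast this
    have h4 : (rhoR m (β + Pi.single i 1) : ℂ) * ((β i : ℂ) + 1)
        = rhoR m β * ((m : ℂ) + (∑ j, β j : ℕ)) := by
      exact_mod_cast bh_rho_succ m hm β i
    field_simp
    linear_combination -h4
  · rw [if_neg hb, if_neg, mul_zero]
    exact fun h => hb (add_right_cancel h)

theorem bh_pow_apply {e : (Fin n → ℕ) → H} {Mz : Fin n → H →L[ℂ] H}
    (hMz : ∀ i α, Mz i (e α) = e (α + Pi.single i 1)) (i : Fin n) (k : ℕ) (α : Fin n → ℕ) :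
    (Mz i ^ k) (e α) = e (α + Pi.single i k) := by
  induction k generalizing α with
  | zero => simp
  | succ k ih =>
    rw [pow_succ, ContinuousLinearMap.mul_apply, hMz, ih, add_assoc, ← Pi.single_add, add_comm 1 k]

theorem bh_list_apply {e : (Fin n → ℕ) → H} {Mz : Fin n → H →L[ℂ] H}
    (hMz : ∀ i α, Mz i (e α) = e (α + Pi.single i 1)) (γ : Fin n → ℕ) (l : List (Fin n))
    (α : Fin n → ℕ) :
    (l.map fun i => Mz i ^ γ i).prod (e α)
      = e (α + (l.map fun i => (Pi.single i (γ i) : Fin n → ℕ)).sum) := by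
  induction l with
  | nil => simp
  | cons a l ih =>
    rw [List.map_cons, List.prod_cons, ContinuousLinearMap.mul_apply, ih, bh_pow_apply hMz,
      List.map_cons, List.sum_cons, add_assoc]
    congr 2
    exact add_comm _ _

theorem bh_MzPow_apply {e : (Fin n → ℕ) → H} {Mz : Fin n → H →L[ℂ] H}
    (hMz : ∀ i α, Mz i (e α) = e (α + Pi.single i 1)) (γ α : Fin n → ℕ) :
    MzPow Mz γ (e α) = e (α + γ) := by
  unfold MzPow
  rw [List.ofFn_eq_map, bh_list_apply hMz, ← List.ofFn_eq_map, List.sum_ofFn,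
    Finset.univ_sum_single]

/-- Linear version of `sigmaOp`. -/
noncomputable def bhSigmaL (Mz : Fin n → H →L[ℂ] H) : (H →L[ℂ] H) →ₗ[ℂ] (H →L[ℂ] H) where
  toFun := sigmaOp Mz
  map_add' X Y := by
    simp [sigmaOp, ContinuousLinearMap.comp_add, ContinuousLinearMap.add_comp,
      Finset.sum_add_distrib]
  map_smul' c X := by
    simp [sigmaOp, ContinuousLinearMap.comp_smul, ContinuousLinearMap.smul_comp,
      Finset.smul_sum]

theorem bhSigmaL_pow (Mz : Fin n → H →L[ℂ] H) (j : ℕ) (X : H →L[ℂ] H) :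
    (bhSigmaL Mz ^ j) X = (sigmaOp Mz)^[j] X := by
  rw [Module.End.pow_apply]; rfl

theorem bh_expand (Mz : Fin n → H →L[ℂ] H) (X : H →L[ℂ] H) :
    sigmaOp Mz (∑ j ∈ Finset.range m,
              ((-1 : ℂ) ^ j * (m.choose (j + 1) : ℂ)) • (sigmaOp Mz)^[j] X)
      = X - ((1 - bhSigmaL Mz) ^ m) X := by
  have h : (1 - bhSigmaL Mz) ^ m = ∑ j ∈ Finset.range (m + 1),
      ((-1 : ℂ) ^ j * (m.choose j : ℂ)) • bhSigmaL Mz ^ j := by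
    have hc : Commute (-bhSigmaL Mz) 1 := Commute.one_right _
    rw [sub_eq_neg_add, hc.add_pow]
    refine Finset.sum_congr rfl fun j _ => ?_
    rw [one_pow, mul_one, ← neg_one_smul ℂ (bhSigmaL Mz), smul_pow, 
      ← (Nat.cast_commute (m.choose j) _).eq, mul_comm _ (m.choose j : ℂ),
      mul_smul, ← nsmul_eq_mul, Nat.cast_smul_eq_nsmul]
  rw [h, Finset.sum_range_succ']
  change bhSigmaL Mz _ = _
  rw [map_sum]
  simp only [LinearMap.add_apply, LinearMap.sum_apply, LinearMap.smul_apply, bhSigmaL_pow,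
    map_smul, Function.iterate_succ_apply', Function.iterate_zero]
  simp only [pow_zero, Nat.choose_zero_right, Nat.cast_one, mul_one, one_smul, id]
  have : ∀ Y, bhSigmaL Mz Y = sigmaOp Mz Y := fun _ => rfl
  simp only [this]
  rw [← sub_sub, sub_right_comm, sub_self, zero_sub, ← Finset.sum_neg_distrib]
  refine Finset.sum_congr rfl fun j _ => ?_
  rw [← neg_smul]
  congr 1
  ring

/-- The eigenvalues occurring in the iterated differences. -/
noncomputable def bhD (m p k : ℕ) : ℂ :=
  (Nat.choose (m - p + k - 1) k : ℂ) / (Nat.choose (m + k - 1) k : ℂ)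

theorem bhD_zero (m p : ℕ) : bhD m p 0 = 1 := by simp [bhD]

theorem bhD_start (m k : ℕ) (hm : 1 ≤ m) : bhD m 0 k = 1 := by
  unfold bhD
  have : (Nat.choose (m + k - 1) k : ℂ) ≠ 0 := by
    have : Nat.choose (m + k - 1) k ≠ 0 := (Nat.choose_pos (by omega)).ne'
    exact_mod_cast this
  simp [this]

theorem bhD_succ (m p k : ℕ) (hp : p + 1 ≤ m) :
    bhD m (p + 1) (k + 1) = bhD m p (k + 1) - ((k : ℂ) + 1) / ((m : ℂ) + k) * bhD m p k := by
  obtain ⟨q, rfl⟩ : ∃ q, m = q + p + 1 := ⟨m - (p + 1), by omega⟩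
  unfold bhD
  have e1 : q + p + 1 - (p + 1) + (k + 1) - 1 = q + k := by omega
  have e2 : q + p + 1 - p + (k + 1) - 1 = q + k + 1 := by omega
  have e3 : q + p + 1 - p + k - 1 = q + k := by omega
  have e4 : q + p + 1 + (k + 1) - 1 = q + p + k + 1 := by omega
  have e5 : q + p + 1 + k - 1 = q + p + k := by omega
  rw [e1, e2, e3, e4, e5, Nat.choose_succ_succ (q + k) k]
  have h1 : ((q + p + k + 1).choose (k + 1) : ℂ) ≠ 0 := by
    have := (Nat.choose_pos (n := q + p + k + 1) (k := k + 1) (by omega)).ne'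
    exact_mod_cast this
  have h2 : ((q + p + k).choose k : ℂ) ≠ 0 := by
    have := (Nat.choose_pos (n := q + p + k) (k := k) (by omega)).ne'
    exact_mod_cast this
  have h3 : ((q + p + 1 : ℕ) : ℂ) + k ≠ 0 := by
    have : q + p + 1 + k ≠ 0 := by omega
    exact_mod_cast this
  have h4 : ((q + p + k + 1 : ℕ) : ℂ) * ((q + p + k).choose k : ℂ)
      = ((q + p + k + 1).choose (k + 1) : ℂ) * ((k + 1 : ℕ) : ℂ) := by
    exact_mod_cast Nat.add_one_mul_choose_eq (q + p + k) k
  have h5 : ((k : ℂ) + 1) / (((q + p + 1 : ℕ) : ℂ) + k)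
      = ((q + p + k).choose k : ℂ) / ((q + p + k + 1).choose (k + 1) : ℂ) := by
    rw [div_eq_div_iff h3 h1]
    push_cast at h4 ⊢
    linear_combination -h4
  rw [h5]
  field_simp
  push_cast
  ring

theorem bhD_end (m k : ℕ) (hk : k ≠ 0) : bhD m m k = 0 := by
  unfold bhD
  rw [Nat.choose_eq_zero_of_lt (by omega)]
  simp

theorem bh_sigma_apply (hm : 1 ≤ m) {e : (Fin n → ℕ) → H}
    (horth : ∀ α β, ⟪e α, e β⟫_ℂ = if α = β then ((rhoR m α)⁻¹ : ℂ) else 0)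
    (hdense : Dense ((Submodule.span ℂ (Set.range e) : Submodule ℂ H) : Set H))
    {Mz : Fin n → H →L[ℂ] H}
    (hMz : ∀ i α, Mz i (e α) = e (α + Pi.single i 1)) (γ : Fin n → ℕ)
    (Y : H →L[ℂ] H) (d : ℕ → ℂ) (hY : ∀ α, Y (e α) = d (∑ i, α i) • e (α + γ))
    (α : Fin n → ℕ) (k : ℕ) (hk : ∑ i, α i = k + 1) :
    sigmaOp Mz Y (e α) = (((k : ℂ) + 1) / ((m : ℂ) + k) * d k) • e (α + γ) := by
  have key : ∀ i, (Mz i).comp (Y.comp (Mz i).adjoint) (e α)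
      = ((α i : ℂ) / ((m : ℂ) + k) * d k) • e (α + γ) := by
    intro i
    rcases Nat.eq_zero_or_pos (α i) with h | h
    · simp [bh_adj_zero horth hdense hMz i α h, h]
    · obtain ⟨β, rfl⟩ : ∃ β, α = β + (Pi.single i 1 : Fin n → ℕ) := by
        refine ⟨α - (Pi.single i 1 : Fin n → ℕ), ?_⟩
        funext j
        by_cases hj : j = i
        · subst hj
          simp only [Pi.add_apply, Pi.sub_apply, Pi.single_eq_same]
          omega
        · simp only [Pi.add_apply, Pi.sub_apply, Pi.single_eq_of_ne hj]
          omega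
      rw [bh_sum_single] at hk
      have hk' : ∑ j, β j = k := by omega
      simp only [ContinuousLinearMap.comp_apply]
      rw [bh_adj_succ hm horth hdense hMz, map_smul, map_smul, hY, map_smul, hMz, smul_smul, hk']
      congr 1
      · simp
      · congr 1
        abel
  unfold sigmaOp
  rw [ContinuousLinearMap.sum_apply, Finset.sum_congr rfl fun i _ => key i, ← Finset.sum_smul,
    ← Finset.sum_mul, ← Finset.sum_div]
  have : ∑ i, (α i : ℂ) = (k : ℂ) + 1 := by exact_mod_cast hk
  rw [this]

theorem bh_sigma_apply_zero {e : (Fin n → ℕ) → H}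
    (horth : ∀ α β, ⟪e α, e β⟫_ℂ = if α = β then ((rhoR m α)⁻¹ : ℂ) else 0)
    (hdense : Dense ((Submodule.span ℂ (Set.range e) : Submodule ℂ H) : Set H))
    {Mz : Fin n → H →L[ℂ] H}
    (hMz : ∀ i α, Mz i (e α) = e (α + Pi.single i 1))
    (Y : H →L[ℂ] H) (α : Fin n → ℕ) (hk : ∑ i, α i = 0) :
    sigmaOp Mz Y (e α) = 0 := by
  unfold sigmaOp
  rw [ContinuousLinearMap.sum_apply]
  refine Finset.sum_eq_zero fun i _ => ?_
  have : α i = 0 := Finset.sum_eq_zero_iff.1 hk i (Finset.mem_univ i)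
  simp [bh_adj_zero horth hdense hMz i α this]

theorem bh_iter (hm : 1 ≤ m) {e : (Fin n → ℕ) → H}
    (horth : ∀ α β, ⟪e α, e β⟫_ℂ = if α = β then ((rhoR m α)⁻¹ : ℂ) else 0)
    (hdense : Dense ((Submodule.span ℂ (Set.range e) : Submodule ℂ H) : Set H))
    {Mz : Fin n → H →L[ℂ] H}
    (hMz : ∀ i α, Mz i (e α) = e (α + Pi.single i 1)) (γ : Fin n → ℕ) (p : ℕ) (hp : p ≤ m)
    (α : Fin n → ℕ) :
    ((1 - bhSigmaL Mz) ^ p) (MzPow Mz γ) (e α) = bhD m p (∑ i, α i) • e (α + γ) := by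
  induction p generalizing α with
  | zero => simp [bh_MzPow_apply hMz, bhD_start _ _ hm]
  | succ p ih =>
    have ih' := ih (by omega)
    rw [pow_succ', Module.End.mul_apply]
    set Y := ((1 - bhSigmaL Mz) ^ p) (MzPow Mz γ)
    change Y (e α) - sigmaOp Mz Y (e α) = _
    rcases hk : ∑ i, α i with _ | k
    · rw [bh_sigma_apply_zero horth hdense hMz Y α hk, ih', hk, bhD_zero, bhD_zero, sub_zero]
    · rw [bh_sigma_apply hm horth hdense hMz γ Y (bhD m p) ih' α k hk, ih', hk, bhD_succ _ _ _ hp,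
        sub_smul]

theorem bh_adj_row {Mz : Fin n → H →L[ℂ] H}
    {Mrow : PiLp 2 (fun _ : Fin n => H) →L[ℂ] H}
    (hMrow : ∀ f, Mrow f = ∑ i, Mz i (f i)) (w : H) (i : Fin n) :
    Mrow.adjoint w i = (Mz i).adjoint w := by
  have : Mrow.adjoint w = WithLp.toLp 2 (fun i => (Mz i).adjoint w) := by
    refine ext_inner_left ℂ fun f => ?_
    rw [ContinuousLinearMap.adjoint_inner_right, hMrow, sum_inner, PiLp.inner_apply]
    refine Finset.sum_congr rfl fun i _ => ?_
    rw [ContinuousLinearMap.adjoint_inner_right]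
  rw [this]

theorem bh_delta_sa {e : (Fin n → ℕ) → H}
    (horth : ∀ α β, ⟪e α, e β⟫_ℂ = if α = β then ((rhoR m α)⁻¹ : ℂ) else 0)
    (hdense : Dense ((Submodule.span ℂ (Set.range e) : Submodule ℂ H) : Set H))
    {δ : H →L[ℂ] H} (c : ℕ → ℝ) (hδ : ∀ α, δ (e α) = (c (∑ i, α i) : ℂ) • e α) :
    δ.adjoint = δ := by
  refine bh_ext_op hdense fun α => bh_ext_vec hdense fun β => ?_
  rw [ContinuousLinearMap.adjoint_inner_right, hδ, hδ, inner_smul_left, inner_smul_right, horth]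
  by_cases h : β = α
  · subst h; simp
  · simp [h]

end BHAux

/-- On `H_m(𝔹)` — modelled abstractly via the orthogonal monomial family `e α` with dense
span — for every multi-index `γ ∈ ℕⁿ` the Brown–Halmos type identity
`M_z'^* M_z^γ M_z' = P_{Im M_z*} (⊕ ∑_{j=0}^{m-1} (-1)^j C(m,j+1) σ_{M_z}^j(M_z^γ)) P_{Im M_z*}`
holds, where `M_z' = δ M_z` is the Cauchy dual, `M_z^γ = M_{z_1}^{γ_1}⋯M_{z_n}^{γ_n}`,
`Q = P_{Im M_z*}` is the orthogonal projection of `H_m(𝔹)ⁿ` onto the range of `M_z*`, and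
`⊕ S` applies `S` in each coordinate. -/
theorem brown_halmos_powers (n m : ℕ) (hm : 1 ≤ m) (γ : Fin n → ℕ)
    {H : Type*} [NormedAddCommGroup H] [InnerProductSpace ℂ H] [CompleteSpace H]
    (e : (Fin n → ℕ) → H)
    (horth : ∀ α β, ⟪e α, e β⟫_ℂ = if α = β then ((rhoR m α)⁻¹ : ℂ) else 0)
    (hdense : Dense ((Submodule.span ℂ (Set.range e) : Submodule ℂ H) : Set H))
    (Mz : Fin n → H →L[ℂ] H)
    (hMz : ∀ i α, Mz i (e α) = e (α + Pi.single i 1))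
    (Mrow : PiLp 2 (fun _ : Fin n => H) →L[ℂ] H)
    (hMrow : ∀ f, Mrow f = ∑ i, Mz i (f i))
    (δ : H →L[ℂ] H)
    (hδ : ∀ α, δ (e α) = if (∑ i, α i) = 0 then e α
        else (((m : ℂ) + (∑ i, α i) - 1) / ((∑ i, α i : ℕ) : ℂ)) • e α)
    (Q : PiLp 2 (fun _ : Fin n => H) →L[ℂ] PiLp 2 (fun _ : Fin n => H))
    (hQsa : IsSelfAdjoint Q)
    (hQran : ∀ v, Q v ∈ closure (Set.range (Mrow).adjoint))
    (hQfix : ∀ v ∈ Set.range (Mrow).adjoint, Q v = v) :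
    ∀ v : PiLp 2 (fun _ : Fin n => H),
      (δ.comp Mrow).adjoint ((MzPow Mz γ) (δ (Mrow v))) =
        Q ((WithLp.equiv 2 (∀ _ : Fin n, H)).symm fun i =>
          (∑ j ∈ Finset.range m,
              ((-1 : ℂ) ^ j * (m.choose (j + 1) : ℂ)) •
                (sigmaOp Mz)^[j] (MzPow Mz γ))
            (Q v i)) := by
  -- the diagonal operator in uniform shape
  have hδ1 : ∀ (α : Fin n → ℕ) (k : ℕ), ∑ i, α i = k + 1 → δ (e α) = (((m : ℂ) + k) / ((k : ℂ) + 1)) • e α := by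
    intro α k hk
    rw [hδ, if_neg (by omega), hk]
    push_cast
    congr 2
    ring
  have hsa : δ.adjoint = δ := by
    refine bh_delta_sa horth hdense
      (fun k => if k = 0 then 1 else ((m : ℝ) + k - 1) / (k : ℝ)) fun α => ?_
    rw [hδ]
    by_cases h : ∑ i, α i = 0
    · simp only [h, if_true]
      simp
    · simp only [h, if_false]
      push_cast
      rfl
  have hrow : ∀ (S : H →L[ℂ] H) (w : H),
      Mrow ((WithLp.equiv 2 (∀ _ : Fin n, H)).symm fun i => S (Mrow.adjoint w i))
        = sigmaOp Mz S w := by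
    intro S w
    rw [hMrow]
    simp [sigmaOp, bh_adj_row hMrow, ContinuousLinearMap.sum_apply]
  have hrow1 : ∀ w : H, Mrow (Mrow.adjoint w) = sigmaOp Mz 1 w := fun w => hrow 1 w
  -- `M* δ M M* = M*`
  have hfix : ∀ w, Mrow.adjoint (δ (Mrow (Mrow.adjoint w))) = Mrow.adjoint w := by
    have : Mrow.adjoint ∘L δ ∘L Mrow ∘L Mrow.adjoint = Mrow.adjoint := by
      refine bh_ext_op hdense fun α => ?_
      simp only [ContinuousLinearMap.comp_apply]
      rw [hrow1]
      rcases hk : ∑ i, α i with _ | k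
      · rw [bh_sigma_apply_zero horth hdense hMz 1 α hk, map_zero, map_zero]
        symm
        ext i
        rw [bh_adj_row hMrow]
        exact bh_adj_zero horth hdense hMz i α
          (Finset.sum_eq_zero_iff.1 hk i (Finset.mem_univ i))
      · rw [bh_sigma_apply hm horth hdense hMz 0 1 (fun _ => 1) (by simp) α k hk, map_smul,
          add_zero, hδ1 α k hk, smul_smul]
        have h1 : (k : ℂ) + 1 ≠ 0 := by exact_mod_cast Nat.succ_ne_zero k
        have h2 : (m : ℂ) + k ≠ 0 := by
          have : m + k ≠ 0 := by omega
          exact_mod_cast this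
        have h3 : ((k : ℂ) + 1) / ((m : ℂ) + k) * 1 * (((m : ℂ) + k) / ((k : ℂ) + 1)) = 1 := by
          field_simp
        rw [h3, one_smul]
    intro w
    exact congrArg (fun A => A w) this
  -- `Q = M* δ M`
  let T : PiLp 2 (fun _ : Fin n => H) →L[ℂ] PiLp 2 (fun _ : Fin n => H) :=
    Mrow.adjoint ∘L δ ∘L Mrow
  have hTsa : T.adjoint = T := by
    simp only [T, ContinuousLinearMap.adjoint_comp, ContinuousLinearMap.adjoint_adjoint, hsa]
    rfl
  have hTQ : T ∘L Q = Q := by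
    ext1 v
    have hcl : IsClosed {u | T u = u} := isClosed_eq T.continuous continuous_id
    have hsub : Set.range Mrow.adjoint ⊆ {u | T u = u} := by
      rintro _ ⟨w, rfl⟩
      exact hfix w
    exact hcl.closure_subset_iff.2 hsub (hQran v)
  have hQT : Q ∘L T = T := by
    ext1 v
    exact hQfix _ ⟨_, rfl⟩
  have hQeq : Q = T := by
    have h := congrArg ContinuousLinearMap.adjoint hTQ
    rw [ContinuousLinearMap.adjoint_comp, hTsa, hQsa.adjoint_eq, hQT] at h
    exact h.symm
  intro v
  have hQ : ∀ u, Q u = Mrow.adjoint (δ (Mrow u)) := fun u => by rw [hQeq]; rfl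
  rw [hQ, hQ v, hrow, bh_expand, ContinuousLinearMap.adjoint_comp, hsa]
  have hW : ((1 - bhSigmaL Mz) ^ m) (MzPow Mz γ) (δ (Mrow v)) = 0 := by
    rw [hMrow, map_sum, map_sum]
    refine Finset.sum_eq_zero fun i _ => ?_
    have : ((1 - bhSigmaL Mz) ^ m) (MzPow Mz γ) ∘L δ ∘L Mz i = 0 := by
      refine bh_ext_op hdense fun α => ?_
      simp only [ContinuousLinearMap.comp_apply]
      rw [hMz, hδ1 _ _ (bh_sum_single α i), map_smul,
        bh_iter hm horth hdense hMz γ m le_rfl, bhD_end _ _ (by rw [bh_sum_single]; omega)]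
      simp
    exact congrArg (fun A => A (v i)) this
  rw [ContinuousLinearMap.sub_apply, hW, sub_zero]
  rfl
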